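/- Let G' = (V, A') be a two-terminal series-parallel directed graph with source s and sink t, let A* ⊆ A' be a set of resetting arcs, and let ν assign a positive capacity to each arc. Then the label function ϱ^{G'} : ℝ_{≥0} → ℝ_{≥0}^V is continuous and piecewise linear with at most 2|A'| − |A*| − |V| + 1 breakpoints. -/

import Mathlib

noncomputable section

open Finset

/-- `f` is affine on each member of a partition of `ℝ≥0` into `m` intervals. -/
def AffinePieces {E : Type*} [AddCommGroup E] [Module ℝ E] (f : ℝ → E) (m : ℕ) : Prop :=
  ∃ P : Finset (Set ℝ), P.card = m ∧
    ⋃₀ (↑P : Set (Set ℝ)) = Set.Ici (0 : ℝ) ∧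
    ((↑P : Set (Set ℝ)).Pairwise fun I J => I ∩ J = ∅) ∧
    (∀ I ∈ P, I.OrdConnected) ∧
    (∀ I ∈ P, ∃ c d : E, ∀ q ∈ I, f q = q • c + d)

/-- The number of breakpoints of a piecewise linear function on `ℝ≥0`:
the minimal `n` such that `ℝ≥0` can be partitioned into `n + 1` intervals
on each of which `f` is affine. -/
def breakpoints {E : Type*} [AddCommGroup E] [Module ℝ E] (f : ℝ → E) : ℕ :=
  sInf {n : ℕ | AffinePieces f (n + 1)}

variable {V A : Type*}

/-- `ϱ^a` for a multigraph arc `a`. -/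
def arcRhoM [DecidableEq A] (Astar : Finset A) (nu : A → ℝ)
    (a : A) (lv xa : ℝ) : ℝ :=
  if a ∈ Astar then xa / nu a else max lv (xa / nu a)

/-- Total flow leaving `v`. -/
def outSumM [DecidableEq V] (Aset : Finset A) (tail : A → V) (x : A → ℝ) (v : V) : ℝ :=
  ∑ a ∈ Aset.filter (fun a => tail a = v), x a

/-- Total flow entering `v`. -/
def inSumM [DecidableEq V] (Aset : Finset A) (head : A → V) (x : A → ℝ) (v : V) : ℝ :=
  ∑ a ∈ Aset.filter (fun a => head a = v), x a

/-- Normalized thin `s`-`t` flow with resetting of value `val` with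
corresponding labels `l` in the multigraph `(Vset, Aset)` with tail and head
maps, resetting arcs `Astar` and capacities `nu`. -/
def IsNTFM [DecidableEq V] [DecidableEq A] (Vset : Finset V) (Aset : Finset A)
    (tail head : A → V) (Astar : Finset A) (nu : A → ℝ)
    (s t : V) (x : A → ℝ) (val : ℝ) (l : V → ℝ) : Prop :=
  (∀ a ∈ Aset, 0 ≤ x a) ∧
  (∀ v ∈ Vset, v ≠ s → v ≠ t →
    outSumM Aset tail x v = inSumM Aset head x v) ∧
  outSumM Aset tail x s - inSumM Aset head x s = val ∧
  (∀ v ∈ Vset, 0 ≤ l v) ∧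
  (∀ w ∈ Vset, w ≠ s →
    (∀ a ∈ Aset, head a = w → l w ≤ arcRhoM Astar nu a (l (tail a)) (x a)) ∧
    (∃ a ∈ Aset, head a = w ∧ l w = arcRhoM Astar nu a (l (tail a)) (x a))) ∧
  (∀ a ∈ Aset, 0 < x a → l (head a) = arcRhoM Astar nu a (l (tail a)) (x a))

/-- The class of two-terminal series-parallel directed (multi)graphs: the
smallest class containing the single-arc graphs that is closed under series
and parallel composition. -/
inductive SeriesParallel [DecidableEq V] [DecidableEq A] (tail head : A → V) :
    Finset V → Finset A → V → V → Prop
  | base (a : A) (s t : V) (hst : s ≠ t) (h1 : tail a = s) (h2 : head a = t) :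
      SeriesParallel tail head {s, t} {a} s t
  | series {V1 V2 : Finset V} {A1 A2 : Finset A} {s r t : V} :
      SeriesParallel tail head V1 A1 s r → SeriesParallel tail head V2 A2 r t →
      V1 ∩ V2 = {r} → Disjoint A1 A2 →
      SeriesParallel tail head (V1 ∪ V2) (A1 ∪ A2) s t
  | parallel {V1 V2 : Finset V} {A1 A2 : Finset A} {s t : V} :
      SeriesParallel tail head V1 A1 s t → SeriesParallel tail head V2 A2 s t →
      V1 ∩ V2 = {s, t} → Disjoint A1 A2 →
      SeriesParallel tail head (V1 ∪ V2) (A1 ∪ A2) s t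

/-- The quantitative properties of the label function `L` of a two-terminal series-parallel graph
with vertex set `Vset`, source `s` and sink `t`, having at most `n` breakpoints.  The pieces are
recorded as the level sets of a monotone index function. -/
structure LabelProfile (Vset : Finset V) (s t : V) (n : ℕ) (L : ℝ → V → ℝ) : Prop where
  source : ∀ q, 0 ≤ q → L q s = 1
  nonneg : ∀ q, 0 ≤ q → 0 ≤ L q t
  pos : ∀ q, 0 < q → 0 < L q t
  mono : ∀ q q', 0 ≤ q → q ≤ q' → L q t ≤ L q' t
  subhom : ∀ q q', 0 ≤ q → q ≤ q' → q * L q' t ≤ q' * L q t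
  determined : ∀ q q', 0 ≤ q → 0 ≤ q' → L q t = L q' t → ∀ v ∈ Vset, L q v = L q' v
  cont : ∀ v ∈ Vset, ContinuousOn (fun q => L q v) (Set.Ici 0)
  growth : ∀ v ∈ Vset, ∃ K, ∀ q, 0 ≤ q → |L q v| ≤ K * (1 + q)
  pieces : ∃ k : ℝ → ℕ, (∀ q q', 0 ≤ q → q ≤ q' → k q ≤ k q') ∧ (∀ q, 0 ≤ q → k q ≤ n) ∧
    ∀ i, ∃ c d : V → ℝ, ∀ q, 0 ≤ q → k q = i → ∀ v ∈ Vset, L q v = q * c v + d v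

/-- `L` determines the labels of every thin flow, whatever the label at the source. -/
def DeterminesLabels [DecidableEq V] [DecidableEq A] (Vset : Finset V) (Aset : Finset A)
    (tail head : A → V) (Astar : Finset A) (nu : A → ℝ) (s t : V) (L : ℝ → V → ℝ) : Prop :=
  ∀ x q l, IsNTFM Vset Aset tail head Astar nu s t x q l →
    (0 < l s → ∀ v ∈ Vset, l v = l s * L (q / l s) v) ∧
    (l s = 0 → q = 0 → ∀ v ∈ Vset, l v = 0)

/-- The label function of a series composition. -/
def seriesLabel [DecidableEq V] (V1 : Finset V) (r : V) (L1 L2 : ℝ → V → ℝ) (q : ℝ) (v : V) : ℝ :=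
  if v ∈ V1 then L1 q v else L1 q r * L2 (q / L1 q r) v

/-- The label function of a parallel composition with flow split `p1`, `p2`. -/
def parallelLabel [DecidableEq V] (V1 : Finset V) (t : V) (L1 L2 : ℝ → V → ℝ) (p1 p2 : ℝ → ℝ)
    (q : ℝ) (v : V) : ℝ :=
  if v = t then min (L1 (p1 q) t) (L2 (p2 q) t) else if v ∈ V1 then L1 (p1 q) v else L2 (p2 q) v

/-- A division of flow between two parallel components with sink labels `h1`, `h2`. -/
structure IsSplit (h1 h2 : ℝ → ℝ) (q a b : ℝ) : Prop where
  left_nonneg : 0 ≤ a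
  right_nonneg : 0 ≤ b
  sum : a + b = q
  left_le : 0 < a → h1 a ≤ h2 b
  right_le : 0 < b → h2 b ≤ h1 a

theorem IsSplit.symm {h1 h2 : ℝ → ℝ} {q a b : ℝ} (h : IsSplit h1 h2 q a b) :
    IsSplit h2 h1 q b a :=
  ⟨h.right_nonneg, h.left_nonneg, by rw [add_comm]; exact h.sum, h.right_le, h.left_le⟩

theorem exists_monotone_split (h1 h2 : ℝ → ℝ)
    (m1 : ∀ q q', 0 ≤ q → q ≤ q' → h1 q ≤ h1 q') (m2 : ∀ q q', 0 ≤ q → q ≤ q' → h2 q ≤ h2 q')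
    (c1 : ContinuousOn h1 (Set.Ici 0)) (c2 : ContinuousOn h2 (Set.Ici 0)) :
    ∃ p1 p2 : ℝ → ℝ, (∀ q, 0 ≤ q → IsSplit h1 h2 q (p1 q) (p2 q)) ∧
      ∀ q q', 0 ≤ q → q ≤ q' → p1 q ≤ p1 q' ∧ p2 q ≤ p2 q' := by
  let S : ℝ → Set ℝ := fun q => {y | y = 0 ∨ (0 ≤ y ∧ y ≤ q ∧ h1 y < h2 (q - y))}
  have hbdd : ∀ q, 0 ≤ q → q ∈ upperBounds (S q) := by
    rintro q hq y (rfl | ⟨_, h, _⟩)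
    exacts [hq, h]
  have hne : ∀ q, (S q).Nonempty := fun q => ⟨0, Or.inl rfl⟩
  have h0 : ∀ q, 0 ≤ q → 0 ≤ sSup (S q) := fun q hq => le_csSup ⟨q, hbdd q hq⟩ (Or.inl rfl)
  have hle : ∀ q, 0 ≤ q → sSup (S q) ≤ q := fun q hq => csSup_le (hne q) (hbdd q hq)
  refine ⟨fun q => sSup (S q), fun q => q - sSup (S q), fun q hq => ⟨h0 q hq, by
    linarith [hle q hq], by ring, ?_, ?_⟩, fun q q' hq hqq => ⟨?_, ?_⟩⟩
  · intro hp
    have hsub : ∀ y ∈ Set.Ico 0 (sSup (S q)), h1 y ≤ h2 (q - y) := by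
      rintro y ⟨hy0, hy⟩
      obtain ⟨z, hz, hyz⟩ := exists_lt_of_lt_csSup (hne q) hy
      rcases hz with rfl | ⟨_, hzq, hz⟩
      · linarith
      · linarith [m1 y z hy0 hyz.le, m2 (q - z) (q - y) (by linarith) (by linarith)]
    refine ContinuousWithinAt.closure_le (s := Set.Ico 0 (sSup (S q))) (f := h1)
      (g := fun y => h2 (q - y)) ?_ ?_ ?_ hsub
    · rw [closure_Ico hp.ne]; exact ⟨hp.le, le_rfl⟩
    · exact (c1 _ (h0 q hq)).mono fun y hy => hy.1
    · refine ContinuousWithinAt.comp (t := Set.Ici 0) (f := fun y => q - y) (g := h2)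
        (c2 _ (sub_nonneg.2 (hle q hq)))
        (by fun_prop) fun y hy => ?_
      have := hle q hq
      have := hy.2
      simp only [Set.mem_Ici]; linarith
  · intro hp
    have hsub : ∀ y ∈ Set.Ioc (sSup (S q)) q, h2 (q - y) ≤ h1 y := by
      rintro y ⟨hy, hyq⟩
      by_contra! hc
      have : y ∈ S q := Or.inr ⟨(h0 q hq).trans hy.le, hyq, hc⟩
      linarith [le_csSup ⟨q, hbdd q hq⟩ this]
    refine ContinuousWithinAt.closure_le (s := Set.Ioc (sSup (S q)) q)
      (f := fun y => h2 (q - y)) (g := h1) ?_ ?_ ?_ hsub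
    · rw [closure_Ioc (by linarith)]; exact ⟨le_rfl, hle q hq⟩
    · refine ContinuousWithinAt.comp (t := Set.Ici 0) (f := fun y => q - y) (g := h2)
        (c2 _ (sub_nonneg.2 (hle q hq)))
        (by fun_prop) fun y hy => ?_
      have := hy.2
      simp only [Set.mem_Ici]; linarith
    · exact (c1 _ (h0 q hq)).mono fun y hy => (h0 q hq).trans hy.1.le
  · refine csSup_le_csSup ⟨q', hbdd q' (hq.trans hqq)⟩ (hne q) ?_
    rintro y (rfl | ⟨hy0, hyq, hy⟩)
    · exact Or.inl rfl
    · exact Or.inr ⟨hy0, hyq.trans hqq,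
        hy.trans_le (m2 _ _ (by linarith) (by linarith))⟩
  · have : sSup (S q') ≤ sSup (S q) + (q' - q) := by
      refine csSup_le (hne q') ?_
      rintro y (rfl | ⟨hy0, hyq, hy⟩)
      · linarith [h0 q hq]
      · rcases le_total (y - (q' - q)) 0 with h | h
        · linarith [h0 q hq]
        · have : y - (q' - q) ∈ S q := by
            refine Or.inr ⟨h, by linarith, ?_⟩
            have e : q - (y - (q' - q)) = q' - y := by ring
            rw [e]
            exact (m1 _ _ h (by linarith)).trans_lt hy
          linarith [le_csSup ⟨q, hbdd q hq⟩ this]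
    linarith

theorem IsSplit.labels_eq {h1 h2 : ℝ → ℝ} {q a b a' b' : ℝ}
    (m1 : ∀ q q', 0 ≤ q → q ≤ q' → h1 q ≤ h1 q') (m2 : ∀ q q', 0 ≤ q → q ≤ q' → h2 q ≤ h2 q')
    (h : IsSplit h1 h2 q a b) (h' : IsSplit h1 h2 q a' b') : h1 a = h1 a' ∧ h2 b = h2 b' := by
  have e := h.sum
  have e' := h'.sum
  rcases lt_trichotomy a a' with hlt | rfl | hlt
  · have g1 := m1 a a' h.left_nonneg hlt.le
    have g2 := h'.left_le (h.left_nonneg.trans_lt hlt)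
    have g3 := m2 b' b h'.right_nonneg (by linarith)
    have g4 := h.right_le (h'.right_nonneg.trans_lt (by linarith))
    constructor <;> linarith
  · have : b = b' := by linarith
    subst this; exact ⟨rfl, rfl⟩
  · have g1 := m1 a' a h'.left_nonneg hlt.le
    have g2 := h.left_le (h'.left_nonneg.trans_lt hlt)
    have g3 := m2 b b' h.right_nonneg (by linarith)
    have g4 := h'.right_le (h.right_nonneg.trans_lt (by linarith))
    constructor <;> linarith

section Series

variable {V1 V2 : Finset V} {s r t : V} {n1 n2 : ℕ} {L1 L2 : ℝ → V → ℝ}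

theorem LabelProfile.sink_pos_of_lt (H : LabelProfile V1 s t n1 L1) {q q' : ℝ} (hq : 0 ≤ q)
    (h : q < q') : 0 < L1 q' t := H.pos q' (hq.trans_lt h)

theorem LabelProfile.eq_zero_of_sink_eq_zero (H : LabelProfile V1 s t n1 L1) {q : ℝ} (hq : 0 ≤ q)
    (h : L1 q t = 0) : q = 0 := by
  by_contra hne
  exact (H.pos q (lt_of_le_of_ne hq (Ne.symm hne))).ne' h

theorem LabelProfile.div_sink_mono (H1 : LabelProfile V1 s r n1 L1) {q q' : ℝ} (hq : 0 ≤ q)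
    (hqq : q ≤ q') : q / L1 q r ≤ q' / L1 q' r := by
  rcases hq.eq_or_lt with rfl | hq0
  · rw [zero_div]; exact div_nonneg hqq (H1.nonneg _ hqq)
  · rw [div_le_div_iff₀ (H1.pos q hq0) (H1.pos q' (hq0.trans_le hqq))]
    exact H1.subhom q q' hq hqq

theorem LabelProfile.scaled_mono (H2 : LabelProfile V2 r t n2 L2) {l l' q : ℝ} (hl : 0 < l)
    (hll : l ≤ l') (hq : 0 ≤ q) : l * L2 (q / l) t ≤ l' * L2 (q / l') t := by
  have hl' := hl.trans_le hll
  rcases hq.eq_or_lt with rfl | hq0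
  · simp only [zero_div]
    exact mul_le_mul_of_nonneg_right hll (H2.nonneg 0 le_rfl)
  · have h := H2.subhom (q / l') (q / l) (by positivity) (by gcongr)
    rw [div_mul_eq_mul_div, div_mul_eq_mul_div, div_le_div_iff₀ hl' hl] at h
    nlinarith

theorem LabelProfile.le_ratio_mul (H : LabelProfile V1 s t n1 L1) {a b c : ℝ} (hb : 0 ≤ b)
    (ha : 0 ≤ a) (hc : 1 ≤ c) (h : b ≤ c * a) : L1 b t ≤ c * L1 a t := by
  have hac : a ≤ c * a := le_mul_of_one_le_left ha hc
  refine (H.mono b (c * a) hb h).trans ?_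
  rcases ha.eq_or_lt with rfl | ha0
  · rw [mul_zero]; exact le_mul_of_one_le_left (H.nonneg 0 le_rfl) hc
  · have := H.subhom a (c * a) ha hac
    nlinarith

variable [DecidableEq V]

theorem seriesLabel_left {q : ℝ} {v : V} (hv : v ∈ V1) : seriesLabel V1 r L1 L2 q v = L1 q v :=
  if_pos hv

theorem seriesLabel_right (H2 : LabelProfile V2 r t n2 L2) (H1 : LabelProfile V1 s r n1 L1)
    (hV : V1 ∩ V2 = {r}) {q : ℝ} (hq : 0 ≤ q) {v : V} (hv : v ∈ V2) :
    seriesLabel V1 r L1 L2 q v = L1 q r * L2 (q / L1 q r) v := by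
  unfold seriesLabel
  split_ifs with h
  · have : v = r := by
      have : v ∈ V1 ∩ V2 := Finset.mem_inter.2 ⟨h, hv⟩
      rwa [hV, Finset.mem_singleton] at this
    subst this
    rw [H2.source _ (div_nonneg hq (H1.nonneg q hq)), mul_one]
  · rfl

theorem LabelProfile.series (H1 : LabelProfile V1 s r n1 L1) (H2 : LabelProfile V2 r t n2 L2)
    (hV : V1 ∩ V2 = {r}) (hs : s ∈ V1) (ht : t ∈ V2) (hr : r ∈ V1) :
    LabelProfile (V1 ∪ V2) s t (n1 + n2) (seriesLabel V1 r L1 L2) := by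
  have left : ∀ {q : ℝ} {v : V}, v ∈ V1 → seriesLabel V1 r L1 L2 q v = L1 q v :=
    fun hv => seriesLabel_left hv
  have right : ∀ {q : ℝ}, 0 ≤ q → ∀ {v : V}, v ∈ V2 →
      seriesLabel V1 r L1 L2 q v = L1 q r * L2 (q / L1 q r) v :=
    fun hq _ hv => seriesLabel_right H2 H1 hV hq hv
  have hdiv : ∀ {q}, 0 ≤ q → 0 ≤ q / L1 q r := fun hq => div_nonneg hq (H1.nonneg _ hq)
  have hpos : ∀ q, 0 < q → 0 < L1 q r * L2 (q / L1 q r) t := fun q hq =>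
    mul_pos (H1.pos q hq) (H2.pos _ (div_pos hq (H1.pos q hq)))
  have hnn : ∀ q, 0 ≤ q → 0 ≤ L1 q r * L2 (q / L1 q r) t := fun q hq =>
    mul_nonneg (H1.nonneg q hq) (H2.nonneg _ (hdiv hq))
  have det : ∀ q q', 0 ≤ q → q ≤ q' →
      L1 q r * L2 (q / L1 q r) t = L1 q' r * L2 (q' / L1 q' r) t →
      ∀ v ∈ V1 ∪ V2, seriesLabel V1 r L1 L2 q v = seriesLabel V1 r L1 L2 q' v := by
    intro q q' hq hqq h v hv
    rcases hqq.eq_or_lt with rfl | hlt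
    · rfl
    have hp' := H1.sink_pos_of_lt hq hlt
    have hq' := hq.trans hqq
    rcases (H1.mono q q' hq hqq).eq_or_lt with e | e
    · rcases Finset.mem_union.1 hv with hv | hv
      · rw [left hv, left hv]; exact H1.determined q q' hq hq' e v hv
      · rw [right hq hv, right hq' hv]
        have h2 := h
        rw [e] at h2 ⊢
        have h3 := mul_left_cancel₀ hp'.ne' h2
        rw [H2.determined _ _ (by rw [← e]; exact hdiv hq) (hdiv hq') h3 v hv]
    · exfalso
      have g1 := H2.mono _ _ (hdiv hq) (H1.div_sink_mono hq hqq)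
      have g2 := H2.pos (q' / L1 q' r) (div_pos (hq.trans_lt hlt) hp')
      have g3 := mul_le_mul_of_nonneg_left g1 (H1.nonneg q hq)
      have g4 := mul_lt_mul_of_pos_right e g2
      linarith
  refine ⟨?_, ?_, ?_, ?_, ?_, ?_, ?_, ?_, ?_⟩
  · intro q hq; rw [left hs]; exact H1.source q hq
  · intro q hq; rw [right hq ht]; exact hnn q hq
  · intro q hq; rw [right hq.le ht]; exact hpos q hq
  · intro q q' hq hqq
    have hq' := hq.trans hqq
    rw [right hq ht, right hq' ht]
    rcases (H1.nonneg q hq).eq_or_lt with e | e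
    · rw [← e, zero_mul]; exact hnn q' hq'
    · calc L1 q r * L2 (q / L1 q r) t ≤ L1 q r * L2 (q' / L1 q r) t := by
            refine mul_le_mul_of_nonneg_left (H2.mono _ _ (hdiv hq) ?_) e.le
            gcongr
        _ ≤ _ := H2.scaled_mono e (H1.mono q q' hq hqq) hq'
  · intro q q' hq hqq
    have hq' := hq.trans hqq
    rw [right hq ht, right hq' ht]
    rcases hq.eq_or_lt with rfl | hq0
    · rw [zero_mul]; exact mul_nonneg hq' (hnn 0 le_rfl)
    · have p := H1.pos q hq0
      have p' := H1.pos q' (hq0.trans_le hqq)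
      have h := H2.subhom _ _ (hdiv hq) (H1.div_sink_mono hq hqq)
      rw [div_mul_eq_mul_div, div_mul_eq_mul_div, div_le_div_iff₀ p p'] at h
      linarith
  · intro q q' hq hq' h v hv
    rw [right hq ht, right hq' ht] at h
    rcases le_total q q' with hqq | hqq
    · exact det q q' hq hqq h v hv
    · exact (det q' q hq' hqq h.symm v hv).symm
  · intro v hv
    rcases Finset.mem_union.1 hv with hv | hv
    · exact (H1.cont v hv).congr fun q _ => left hv
    · refine ContinuousOn.congr (f := fun q => L1 q r * L2 (q / L1 q r) v) ?_
        fun q hq => right hq hv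
      intro q (hq : 0 ≤ q)
      have cr := H1.cont r hr q hq
      rcases (H1.nonneg q hq).eq_or_lt with e | e
      · have hq0 : q = 0 := H1.eq_zero_of_sink_eq_zero hq e.symm
        obtain ⟨K, hK⟩ := H2.growth v hv
        have hK0 : 0 ≤ K := by
          have := (abs_nonneg _).trans (hK 0 le_rfl)
          linarith
        change Filter.Tendsto _ _ (nhds (L1 q r * L2 (q / L1 q r) v))
        rw [← e, zero_mul]
        have lim : Filter.Tendsto (fun y => K * (L1 y r + y)) (nhdsWithin q (Set.Ici 0))
            (nhds 0) := by
          have : ContinuousWithinAt (fun y => K * (L1 y r + y)) (Set.Ici 0) q :=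
            continuousWithinAt_const.mul (cr.add continuousWithinAt_id)
          have val : K * (L1 q r + q) = 0 := by rw [← e, hq0]; ring
          have h2 := this.tendsto
          rwa [val] at h2
        refine squeeze_zero_norm' ?_ lim
        filter_upwards [self_mem_nhdsWithin] with y hy
        rw [Real.norm_eq_abs, abs_mul, abs_of_nonneg (H1.nonneg y hy)]
        rcases (H1.nonneg y hy).eq_or_lt with e' | e'
        · rw [← e', zero_mul, zero_add]; exact mul_nonneg hK0 hy
        · calc L1 y r * |L2 (y / L1 y r) v| ≤ L1 y r * (K * (1 + y / L1 y r)) :=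
                mul_le_mul_of_nonneg_left (hK _ (hdiv hy)) e'.le
            _ = K * (L1 y r + y) := by field_simp
      · refine cr.mul (ContinuousWithinAt.comp (t := Set.Ici 0) (f := fun y => y / L1 y r)
          (g := fun y => L2 y v) (H2.cont v hv _ (hdiv hq)) ?_ fun y hy => hdiv hy)
        exact continuousWithinAt_id.div cr e.ne'
  · intro v hv
    rcases Finset.mem_union.1 hv with hv | hv
    · obtain ⟨K, hK⟩ := H1.growth v hv
      exact ⟨K, fun q hq => by rw [left hv]; exact hK q hq⟩
    · obtain ⟨K, hK⟩ := H2.growth v hv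
      obtain ⟨M, hM⟩ := H1.growth r hr
      have hK0 : 0 ≤ K := by
        have := (abs_nonneg _).trans (hK 0 le_rfl)
        linarith
      have hM0 : 0 ≤ M := by
        have := (abs_nonneg _).trans (hM 0 le_rfl)
        linarith
      refine ⟨K * (M + 1), fun q hq => ?_⟩
      rw [right hq hv, abs_mul]
      have h1 := hM q hq
      rw [abs_of_nonneg (H1.nonneg q hq)] at h1 ⊢
      rcases (H1.nonneg q hq).eq_or_lt with e' | e'
      · rw [← e', zero_mul]; positivity
      · calc L1 q r * |L2 (q / L1 q r) v| ≤ L1 q r * (K * (1 + q / L1 q r)) :=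
                mul_le_mul_of_nonneg_left (hK _ (hdiv hq)) e'.le
            _ = K * (L1 q r + q) := by field_simp
            _ ≤ K * ((M + 1) * (1 + q)) := by
              refine mul_le_mul_of_nonneg_left ?_ hK0
              linarith
            _ = _ := by ring
  · obtain ⟨k1, mk1, bk1, ak1⟩ := H1.pieces
    obtain ⟨k2, mk2, bk2, ak2⟩ := H2.pieces
    have mk : ∀ q q', 0 ≤ q → q ≤ q' → k2 (q / L1 q r) ≤ k2 (q' / L1 q' r) := fun q q' hq hqq =>
      mk2 _ _ (hdiv hq) (H1.div_sink_mono hq hqq)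
    refine ⟨fun q => k1 q + k2 (q / L1 q r), fun q q' hq hqq =>
      add_le_add (mk1 q q' hq hqq) (mk q q' hq hqq),
      fun q hq => add_le_add (bk1 q hq) (bk2 _ (hdiv hq)), fun i => ?_⟩
    by_cases hi : ∃ q0, 0 ≤ q0 ∧ k1 q0 + k2 (q0 / L1 q0 r) = i
    · obtain ⟨q0, hq0, rfl⟩ := hi
      obtain ⟨c1, d1, h1⟩ := ak1 (k1 q0)
      obtain ⟨c2, d2, h2⟩ := ak2 (k2 (q0 / L1 q0 r))
      refine ⟨fun v => if v ∈ V1 then c1 v else c2 v + c1 r * d2 v,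
        fun v => if v ∈ V1 then d1 v else d1 r * d2 v, fun q hq hk v hv => ?_⟩
      change k1 q + k2 (q / L1 q r) = _ at hk
      have hk12 : k1 q = k1 q0 ∧ k2 (q / L1 q r) = k2 (q0 / L1 q0 r) := by
        rcases le_total q q0 with hqq | hqq
        · have := mk1 q q0 hq hqq
          have := mk q q0 hq hqq
          omega
        · have := mk1 q0 q hq0 hqq
          have := mk q0 q hq0 hqq
          omega
      by_cases hv1 : v ∈ V1
      · simp only [hv1, if_true]
        rw [left hv1]; exact h1 q hq hk12.1 v hv1
      · have hv2 : v ∈ V2 := (Finset.mem_union.1 hv).resolve_left hv1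
        simp only [hv1, if_false]
        rw [right hq hv2, h2 _ (hdiv hq) hk12.2 v hv2]
        have e := h1 q hq hk12.1 r hr
        rcases (H1.nonneg q hq).eq_or_lt with e' | e'
        · have hq0 : q = 0 := H1.eq_zero_of_sink_eq_zero hq e'.symm
          rw [← e'] at e ⊢
          rw [hq0] at e ⊢
          linear_combination d2 v * e
        · have : L1 q r * (q / L1 q r * c2 v + d2 v) = q * c2 v + L1 q r * d2 v := by
            field_simp
          rw [this, e]; ring
    · exact ⟨0, 0, fun q hq hk => absurd ⟨q, hq, hk⟩ hi⟩

end Series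

section Parallel

variable [DecidableEq V] {V1 V2 : Finset V} {s t : V} {n1 n2 : ℕ} {L1 L2 : ℝ → V → ℝ}
  {p1 p2 : ℝ → ℝ}

theorem parallelLabel_sink (q : ℝ) :
    parallelLabel V1 t L1 L2 p1 p2 q t = min (L1 (p1 q) t) (L2 (p2 q) t) :=
  if_pos rfl

theorem parallelLabel_left {q : ℝ} {v : V} (hv : v ∈ V1) (hvt : v ≠ t) :
    parallelLabel V1 t L1 L2 p1 p2 q v = L1 (p1 q) v := by
  simp [parallelLabel, hv, hvt]

theorem parallelLabel_right (H1 : LabelProfile V1 s t n1 L1) (H2 : LabelProfile V2 s t n2 L2)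
    (hV : V1 ∩ V2 = {s, t}) {q : ℝ} (h1 : 0 ≤ p1 q) (h2 : 0 ≤ p2 q) {v : V} (hv : v ∈ V2)
    (hvt : v ≠ t) : parallelLabel V1 t L1 L2 p1 p2 q v = L2 (p2 q) v := by
  unfold parallelLabel
  rw [if_neg hvt]
  split_ifs with h
  · have : v = s := by
      have : v ∈ V1 ∩ V2 := Finset.mem_inter.2 ⟨h, hv⟩
      rw [hV, Finset.mem_insert, Finset.mem_singleton] at this
      exact this.resolve_right hvt
    subst this
    rw [H1.source _ h1, H2.source _ h2]
  · rfl

theorem continuousOn_of_monotone_sum {p p' : ℝ → ℝ} (hsum : ∀ q, 0 ≤ q → p q + p' q = q)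
    (m : ∀ q q', 0 ≤ q → q ≤ q' → p q ≤ p q' ∧ p' q ≤ p' q') :
    ContinuousOn p (Set.Ici 0) := by
  have hL : LipschitzOnWith 1 p (Set.Ici 0) := by
    refine LipschitzOnWith.of_le_add_mul 1 fun a (ha : 0 ≤ a) b (hb : 0 ≤ b) => ?_
    rw [NNReal.coe_one, one_mul, Real.dist_eq]
    have ea := hsum a ha
    have eb := hsum b hb
    rcases le_total a b with h | h
    · linarith [(m a b ha h).1, abs_nonneg (a - b)]
    · linarith [(m b a hb h).2, le_abs_self (a - b)]
  exact hL.continuousOn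

/-- Two shares of a total `q` at which two affine functions agree depend affinely on `q`. -/
theorem exists_affine_share {c1 d1 c2 d2 : ℝ} (hc : c1 + c2 ≠ 0) :
    ∃ α β : ℝ, ∀ a b q : ℝ, a + b = q → a * c1 + d1 = b * c2 + d2 →
      a = q * α + β ∧ b = q * (1 - α) - β := by
  have key : ∀ a b q : ℝ, a + b = q → a * c1 + d1 = b * c2 + d2 →
      a = q * (c2 / (c1 + c2)) + (d2 - d1) / (c1 + c2) := by
    intro a b q hq h
    field_simp
    rw [← hq]
    linarith
  exact ⟨c2 / (c1 + c2), (d2 - d1) / (c1 + c2), fun a b q hq h =>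
    ⟨key a b q hq h, by linarith [key a b q hq h]⟩⟩

theorem LabelProfile.parallel (H1 : LabelProfile V1 s t n1 L1) (H2 : LabelProfile V2 s t n2 L2)
    (hV : V1 ∩ V2 = {s, t}) (hst : s ≠ t)
    (sp : ∀ q, 0 ≤ q → IsSplit (fun y => L1 y t) (fun y => L2 y t) q (p1 q) (p2 q))
    (m : ∀ q q', 0 ≤ q → q ≤ q' → p1 q ≤ p1 q' ∧ p2 q ≤ p2 q') :
    LabelProfile (V1 ∪ V2) s t (n1 + n2 + 1) (parallelLabel V1 t L1 L2 p1 p2) := by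
  have hmem : ∀ v, v ∈ V1 ∩ V2 ↔ v = s ∨ v = t := by simp [hV]
  have hs1 : s ∈ V1 := (Finset.mem_inter.1 ((hmem s).2 (Or.inl rfl))).1
  have ht1 : t ∈ V1 := (Finset.mem_inter.1 ((hmem t).2 (Or.inr rfl))).1
  have ht2 : t ∈ V2 := (Finset.mem_inter.1 ((hmem t).2 (Or.inr rfl))).2
  set L := parallelLabel V1 t L1 L2 p1 p2
  have sink : ∀ q, L q t = min (L1 (p1 q) t) (L2 (p2 q) t) := fun q => parallelLabel_sink q
  have left : ∀ {q : ℝ} {v : V}, v ∈ V1 → v ≠ t → L q v = L1 (p1 q) v :=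
    fun hv hvt => parallelLabel_left hv hvt
  have nn1 : ∀ q, 0 ≤ q → 0 ≤ p1 q := fun q hq => (sp q hq).left_nonneg
  have nn2 : ∀ q, 0 ≤ q → 0 ≤ p2 q := fun q hq => (sp q hq).right_nonneg
  have hsum : ∀ q, 0 ≤ q → p1 q + p2 q = q := fun q hq => (sp q hq).sum
  have hle1 : ∀ q, 0 ≤ q → 0 < p1 q → L1 (p1 q) t ≤ L2 (p2 q) t := fun q hq => (sp q hq).left_le
  have hle2 : ∀ q, 0 ≤ q → 0 < p2 q → L2 (p2 q) t ≤ L1 (p1 q) t := fun q hq => (sp q hq).right_le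
  have right : ∀ {q : ℝ}, 0 ≤ q → ∀ {v : V}, v ∈ V2 → v ≠ t → L q v = L2 (p2 q) v :=
    fun hq _ hv hvt => parallelLabel_right H1 H2 hV (nn1 _ hq) (nn2 _ hq) hv hvt
  have mono1 : ∀ q q', 0 ≤ q → q ≤ q' → L1 (p1 q) t ≤ L1 (p1 q') t := fun q q' hq hqq =>
    H1.mono _ _ (nn1 q hq) (m q q' hq hqq).1
  have mono2 : ∀ q q', 0 ≤ q → q ≤ q' → L2 (p2 q) t ≤ L2 (p2 q') t := fun q q' hq hqq =>
    H2.mono _ _ (nn2 q hq) (m q q' hq hqq).2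
  have mono : ∀ q q', 0 ≤ q → q ≤ q' → L q t ≤ L q' t := by
    intro q q' hq hqq
    rw [sink, sink]
    exact min_le_min (mono1 q q' hq hqq) (mono2 q q' hq hqq)
  have det : ∀ q q', 0 ≤ q → q ≤ q' → L q t = L q' t →
      L1 (p1 q) t = L1 (p1 q') t ∧ L2 (p2 q) t = L2 (p2 q') t := by
    intro q q' hq hqq h
    have hq' := hq.trans hqq
    rw [sink, sink] at h
    constructor
    · by_contra hne
      have hlt := lt_of_le_of_ne (mono1 q q' hq hqq) hne
      have hp : p1 q < p1 q' := lt_of_le_of_ne (m q q' hq hqq).1 fun e => hne (by rw [e])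
      have := hle1 q' hq' ((nn1 q hq).trans_lt hp)
      rw [min_eq_left this] at h
      linarith [min_le_left (L1 (p1 q) t) (L2 (p2 q) t)]
    · by_contra hne
      have hlt := lt_of_le_of_ne (mono2 q q' hq hqq) hne
      have hp : p2 q < p2 q' := lt_of_le_of_ne (m q q' hq hqq).2 fun e => hne (by rw [e])
      have := hle2 q' hq' ((nn2 q hq).trans_lt hp)
      rw [min_eq_right this] at h
      linarith [min_le_right (L1 (p1 q) t) (L2 (p2 q) t)]
  have det_labels_le : ∀ q q', 0 ≤ q → q ≤ q' → L q t = L q' t → ∀ v ∈ V1 ∪ V2, L q v = L q' v := by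
    intro q q' hq hqq h v hv
    have hq' := hq.trans hqq
    by_cases hvt : v = t
    · rw [hvt]; exact h
    obtain ⟨e1, e2⟩ := det q q' hq hqq h
    rcases Finset.mem_union.1 hv with hv | hv
    · rw [left hv hvt, left hv hvt]
      exact H1.determined _ _ (nn1 q hq) (nn1 q' hq') e1 v hv
    · rw [right hq hv hvt, right hq' hv hvt]
      exact H2.determined _ _ (nn2 q hq) (nn2 q' hq') e2 v hv
  have det_labels : ∀ q q', 0 ≤ q → 0 ≤ q' → L q t = L q' t → ∀ v ∈ V1 ∪ V2, L q v = L q' v := by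
    intro q q' hq hq' h v hv
    rcases le_total q q' with hqq | hqq
    · exact det_labels_le q q' hq hqq h v hv
    · exact (det_labels_le q' q hq' hqq h.symm v hv).symm
  have cp1 : ContinuousOn p1 (Set.Ici 0) := continuousOn_of_monotone_sum hsum m
  have cp2 : ContinuousOn p2 (Set.Ici 0) := continuousOn_of_monotone_sum (p' := p1)
    (fun q hq => by rw [add_comm]; exact hsum q hq) fun q q' hq hqq => (m q q' hq hqq).symm
  have cL1 : ∀ v ∈ V1, ContinuousOn (fun q => L1 (p1 q) v) (Set.Ici 0) := fun v hv =>
    (H1.cont v hv).comp cp1 fun q hq => nn1 q hq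
  have cL2 : ∀ v ∈ V2, ContinuousOn (fun q => L2 (p2 q) v) (Set.Ici 0) := fun v hv =>
    (H2.cont v hv).comp cp2 fun q hq => nn2 q hq
  have gr1 : ∀ v ∈ V1, ∃ K, ∀ q, 0 ≤ q → |L1 (p1 q) v| ≤ K * (1 + q) := by
    intro v hv
    obtain ⟨K, hK⟩ := H1.growth v hv
    have hK0 : 0 ≤ K := by
      have := (abs_nonneg _).trans (hK 0 le_rfl)
      linarith
    refine ⟨K, fun q hq => (hK _ (nn1 q hq)).trans ?_⟩
    have := hsum q hq
    have := nn2 q hq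
    exact mul_le_mul_of_nonneg_left (by linarith) hK0
  have gr2 : ∀ v ∈ V2, ∃ K, ∀ q, 0 ≤ q → |L2 (p2 q) v| ≤ K * (1 + q) := by
    intro v hv
    obtain ⟨K, hK⟩ := H2.growth v hv
    have hK0 : 0 ≤ K := by
      have := (abs_nonneg _).trans (hK 0 le_rfl)
      linarith
    refine ⟨K, fun q hq => (hK _ (nn2 q hq)).trans ?_⟩
    have := hsum q hq
    have := nn1 q hq
    exact mul_le_mul_of_nonneg_left (by linarith) hK0
  have nonneg : ∀ q, 0 ≤ q → 0 ≤ L q t := fun q hq => by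
    rw [sink]; exact le_min (H1.nonneg _ (nn1 q hq)) (H2.nonneg _ (nn2 q hq))
  refine ⟨?_, nonneg, ?_, mono, ?_, det_labels, ?_, ?_, ?_⟩
  · intro q hq; rw [left hs1 hst]; exact H1.source _ (nn1 q hq)
  · intro q hq
    rw [sink]
    by_cases h : 0 < p1 q
    · rw [min_eq_left (hle1 q hq.le h)]; exact H1.pos _ h
    · have h2 : 0 < p2 q := by linarith [hsum q hq.le]
      rw [min_eq_right (hle2 q hq.le h2)]; exact H2.pos _ h2
  · intro q q' hq hqq
    have hq' := hq.trans hqq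
    rcases hq.eq_or_lt with rfl | hq0
    · rw [zero_mul]; exact mul_nonneg hq' (nonneg 0 le_rfl)
    have hc : 1 ≤ q' / q := (one_le_div hq0).2 hqq
    have hcq : q' / q * q = q' := by field_simp
    suffices h : L q' t ≤ q' / q * L q t by
      calc q * L q' t ≤ q * (q' / q * L q t) := mul_le_mul_of_nonneg_left h hq
        _ = _ := by field_simp
    have s1 := hsum q hq
    have s2 := hsum q' hq'
    have caseL : 0 < p1 q → p1 q' ≤ q' / q * p1 q → L q' t ≤ q' / q * L q t := by
      intro h0 h
      rw [sink, sink, min_eq_left (hle1 q hq h0)]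
      exact (min_le_left _ _).trans (H1.le_ratio_mul (nn1 q' hq') h0.le hc h)
    have caseR : 0 < p2 q → p2 q' ≤ q' / q * p2 q → L q' t ≤ q' / q * L q t := by
      intro h0 h
      rw [sink, sink, min_eq_right (hle2 q hq h0)]
      exact (min_le_right _ _).trans (H2.le_ratio_mul (nn2 q' hq') h0.le hc h)
    have tot : p1 q' + p2 q' = q' / q * p1 q + q' / q * p2 q := by
      rw [← mul_add, s1, hcq, s2]
    rcases (nn1 q hq).eq_or_lt with e1 | e1
    · refine caseR (by linarith) ?_
      rw [← e1, mul_zero] at tot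
      linarith [nn1 q' hq']
    rcases (nn2 q hq).eq_or_lt with e2 | e2
    · refine caseL (by linarith) ?_
      rw [← e2, mul_zero] at tot
      linarith [nn2 q' hq']
    rcases le_total (p1 q') (q' / q * p1 q) with h | h
    · exact caseL e1 h
    · exact caseR e2 (by linarith)
  · intro v hv
    by_cases hvt : v = t
    · rw [hvt]
      exact ((cL1 t ht1).inf (cL2 t ht2)).congr fun q _ => sink q
    rcases Finset.mem_union.1 hv with hv | hv
    · exact (cL1 v hv).congr fun q _ => left hv hvt
    · exact (cL2 v hv).congr fun q hq => right hq hv hvt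
  · intro v hv
    by_cases hvt : v = t
    · obtain ⟨K, hK⟩ := gr1 t ht1
      refine ⟨K, fun q hq => ?_⟩
      rw [hvt, abs_of_nonneg (nonneg q hq), sink]
      exact (min_le_left _ _).trans ((le_abs_self _).trans (hK q hq))
    rcases Finset.mem_union.1 hv with hv | hv
    · obtain ⟨K, hK⟩ := gr1 v hv
      exact ⟨K, fun q hq => by rw [left hv hvt]; exact hK q hq⟩
    · obtain ⟨K, hK⟩ := gr2 v hv
      exact ⟨K, fun q hq => by rw [right hq hv hvt]; exact hK q hq⟩
  · obtain ⟨k1, mk1, bk1, ak1⟩ := H1.pieces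
    obtain ⟨k2, mk2, bk2, ak2⟩ := H2.pieces
    -- the strict inequalities hold only while one component is unused
    have un1 : ∀ q, 0 ≤ q → L2 (p2 q) t < L1 (p1 q) t → p1 q = 0 := fun q hq h => by
      by_contra hne
      exact (hle1 q hq (lt_of_le_of_ne (nn1 q hq) (Ne.symm hne))).not_gt h
    have un2 : ∀ q, 0 ≤ q → L1 (p1 q) t < L2 (p2 q) t → p2 q = 0 := fun q hq h => by
      by_contra hne
      exact (hle2 q hq (lt_of_le_of_ne (nn2 q hq) (Ne.symm hne))).not_gt h
    have gt0 : ∀ q, 0 ≤ q → L2 (p2 q) t < L1 (p1 q) t → L2 0 t < L1 0 t := fun q hq h => by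
      have := H2.mono 0 _ le_rfl (nn2 q hq)
      rw [un1 q hq h] at h
      linarith
    have lt0 : ∀ q, 0 ≤ q → L1 (p1 q) t < L2 (p2 q) t → L1 0 t < L2 0 t := fun q hq h => by
      have := H1.mono 0 _ le_rfl (nn1 q hq)
      rw [un2 q hq h] at h
      linarith
    have stay : ∀ q q', 0 ≤ q → q ≤ q' → L1 (p1 q) t = L2 (p2 q) t →
        L1 (p1 q') t = L2 (p2 q') t := by
      intro q q' hq hqq h
      have hq' := hq.trans hqq
      by_contra hne
      rcases lt_or_gt_of_ne hne with hlt | hlt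
      · have e := un2 q' hq' hlt
        have e0 : p2 q = 0 := le_antisymm (e ▸ (m q q' hq hqq).2) (nn2 q hq)
        have := mono1 q q' hq hqq
        rw [e] at hlt
        rw [e0] at h
        linarith
      · have e := un1 q' hq' hlt
        have e0 : p1 q = 0 := le_antisymm (e ▸ (m q q' hq hqq).1) (nn1 q hq)
        have := mono2 q q' hq hqq
        rw [e] at hlt
        rw [e0] at h
        linarith
    let ph : ℝ → ℕ := fun q => if L1 (p1 q) t = L2 (p2 q) t then 1 else 0
    have mph : ∀ q q', 0 ≤ q → q ≤ q' → ph q ≤ ph q' := by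
      intro q q' hq hqq
      by_cases h : L1 (p1 q) t = L2 (p2 q) t
      · simp [ph, h, stay q q' hq hqq h]
      · simp [ph, h]
    have bph : ∀ q, ph q ≤ 1 := fun q => by
      simp only [ph]; split_ifs <;> omega
    have mk1' : ∀ q q', 0 ≤ q → q ≤ q' → k1 (p1 q) ≤ k1 (p1 q') := fun q q' hq hqq =>
      mk1 _ _ (nn1 q hq) (m q q' hq hqq).1
    have mk2' : ∀ q q', 0 ≤ q → q ≤ q' → k2 (p2 q) ≤ k2 (p2 q') := fun q q' hq hqq =>
      mk2 _ _ (nn2 q hq) (m q q' hq hqq).2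
    refine ⟨fun q => k1 (p1 q) + k2 (p2 q) + ph q, fun q q' hq hqq =>
      add_le_add (add_le_add (mk1' q q' hq hqq) (mk2' q q' hq hqq)) (mph q q' hq hqq),
      fun q hq => add_le_add (add_le_add (bk1 _ (nn1 q hq)) (bk2 _ (nn2 q hq))) (bph q),
      fun i => ?_⟩
    by_cases hi : ∃ q0, 0 ≤ q0 ∧ k1 (p1 q0) + k2 (p2 q0) + ph q0 = i
    swap
    · exact ⟨0, 0, fun q hq hk => absurd ⟨q, hq, hk⟩ hi⟩
    obtain ⟨q0, hq0, rfl⟩ := hi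
    obtain ⟨c1, d1, h1⟩ := ak1 (k1 (p1 q0))
    obtain ⟨c2, d2, h2⟩ := ak2 (k2 (p2 q0))
    have split : ∀ q, 0 ≤ q → k1 (p1 q) + k2 (p2 q) + ph q = k1 (p1 q0) + k2 (p2 q0) + ph q0 →
        k1 (p1 q) = k1 (p1 q0) ∧ k2 (p2 q) = k2 (p2 q0) ∧ ph q = ph q0 := by
      intro q hq hk
      rcases le_total q q0 with hqq | hqq
      · have := mk1' q q0 hq hqq
        have := mk2' q q0 hq hqq
        have := mph q q0 hq hqq
        omega
      · have := mk1' q0 q hq0 hqq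
        have := mk2' q0 q hq0 hqq
        have := mph q0 q hq0 hqq
        omega
    have aff1 : ∀ q, 0 ≤ q → k1 (p1 q) = k1 (p1 q0) → ∀ v ∈ V1,
        L1 (p1 q) v = p1 q * c1 v + d1 v := fun q hq hk v hv => h1 _ (nn1 q hq) hk v hv
    have aff2 : ∀ q, 0 ≤ q → k2 (p2 q) = k2 (p2 q0) → ∀ v ∈ V2,
        L2 (p2 q) v = p2 q * c2 v + d2 v := fun q hq hk v hv => h2 _ (nn2 q hq) hk v hv
    by_cases hph : L1 (p1 q0) t = L2 (p2 q0) t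
    · have eq_of : ∀ q, ph q = ph q0 → L1 (p1 q) t = L2 (p2 q) t := by
        intro q h
        by_contra hne
        simp [ph, hph, hne] at h
      by_cases hconst : ∀ q, 0 ≤ q →
          k1 (p1 q) + k2 (p2 q) + ph q = k1 (p1 q0) + k2 (p2 q0) + ph q0 → L q t = L q0 t
      · refine ⟨0, L q0, fun q hq hk v hv => ?_⟩
        rw [Pi.zero_apply, mul_zero, zero_add]
        exact det_labels q q0 hq hq0 (hconst q hq hk) v hv
      push Not at hconst
      obtain ⟨q1, hq1, hk1, hne⟩ := hconst
      obtain ⟨x1, x2, x3⟩ := split q1 hq1 hk1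
      have e1 := eq_of q1 x3
      have slope : c1 t + c2 t ≠ 0 := by
        rw [sink, sink, ← e1, ← hph, min_self, min_self] at hne
        have y1 := aff1 q1 hq1 x1 t ht1
        have z1 := aff1 q0 hq0 rfl t ht1
        have y2 := aff2 q1 hq1 x2 t ht2
        have z2 := aff2 q0 hq0 rfl t ht2
        have pos_slope : ∀ a b : ℝ, ∀ c d : ℝ, a ≤ b → a * c + d < b * c + d → 0 < c := by
          intro a b c d hab h
          nlinarith
        have ne_of : L1 (p1 q1) t ≠ L1 (p1 q0) t := hne
        rcases lt_or_gt_of_ne ne_of with hlt | hlt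
        · have hqq : q1 ≤ q0 := by
            by_contra! hc
            exact (mono1 q0 q1 hq0 hc.le).not_gt hlt
          have w1 := pos_slope (p1 q1) (p1 q0) (c1 t) (d1 t) (m q1 q0 hq1 hqq).1 (by linarith)
          have w2 := pos_slope (p2 q1) (p2 q0) (c2 t) (d2 t) (m q1 q0 hq1 hqq).2 (by linarith)
          linarith
        · have hqq : q0 ≤ q1 := by
            by_contra! hc
            exact (mono1 q1 q0 hq1 hc.le).not_gt hlt
          have w1 := pos_slope (p1 q0) (p1 q1) (c1 t) (d1 t) (m q0 q1 hq0 hqq).1 (by linarith)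
          have w2 := pos_slope (p2 q0) (p2 q1) (c2 t) (d2 t) (m q0 q1 hq0 hqq).2 (by linarith)
          linarith
      obtain ⟨α, β, share⟩ := exists_affine_share (d1 := d1 t) (d2 := d2 t) slope
      refine ⟨fun v => if v ∈ V1 then α * c1 v else (1 - α) * c2 v,
        fun v => if v ∈ V1 then β * c1 v + d1 v else d2 v - β * c2 v, fun q hq hk v hv => ?_⟩
      obtain ⟨x1, x2, x3⟩ := split q hq hk
      have e := eq_of q x3
      obtain ⟨sh1, sh2⟩ := share (p1 q) (p2 q) q (hsum q hq)
        (by rw [← aff1 q hq x1 t ht1, ← aff2 q hq x2 t ht2]; exact e)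
      by_cases hv1 : v ∈ V1
      · have : L q v = L1 (p1 q) v := by
          by_cases hvt : v = t
          · rw [hvt, sink, ← e, min_self]
          · exact left hv1 hvt
        simp only [hv1, if_true]
        rw [this, aff1 q hq x1 v hv1, sh1]; ring
      · have hv2 := (Finset.mem_union.1 hv).resolve_left hv1
        have hvt : v ≠ t := fun h => hv1 (h ▸ ht1)
        simp only [hv1, if_false]
        rw [right hq hv2 hvt, aff2 q hq x2 v hv2, sh2]; ring
    · have ne_of : ∀ q, ph q = ph q0 → L1 (p1 q) t ≠ L2 (p2 q) t := by
        intro q h he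
        simp [ph, hph, he] at h
      rcases lt_or_gt_of_ne hph with hlt | hlt
      · have h00 := lt0 q0 hq0 hlt
        refine ⟨fun v => if v ∈ V1 then c1 v else 0,
          fun v => if v ∈ V1 then d1 v else L2 0 v, fun q hq hk v hv => ?_⟩
        obtain ⟨x1, x2, x3⟩ := split q hq hk
        have hltq : L1 (p1 q) t < L2 (p2 q) t := lt_of_le_of_ne
          (by by_contra! hc; exact lt_asymm h00 (gt0 q hq hc)) (ne_of q x3)
        have hz := un2 q hq hltq
        have hp : p1 q = q := by linarith [hsum q hq]
        by_cases hv1 : v ∈ V1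
        · have : L q v = L1 (p1 q) v := by
            by_cases hvt : v = t
            · rw [hvt, sink, min_eq_left hltq.le]
            · exact left hv1 hvt
          simp only [hv1, if_true]
          rw [this, aff1 q hq x1 v hv1, hp]
        · have hv2 := (Finset.mem_union.1 hv).resolve_left hv1
          have hvt : v ≠ t := fun h => hv1 (h ▸ ht1)
          simp only [hv1, if_false]
          rw [right hq hv2 hvt, hz, mul_zero, zero_add]
      · have h00 := gt0 q0 hq0 hlt
        refine ⟨fun v => if v ∈ V2 then c2 v else 0,
          fun v => if v ∈ V2 then d2 v else L1 0 v, fun q hq hk v hv => ?_⟩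
        obtain ⟨x1, x2, x3⟩ := split q hq hk
        have hltq : L2 (p2 q) t < L1 (p1 q) t := lt_of_le_of_ne
          (by by_contra! hc; exact lt_asymm h00 (lt0 q hq hc)) (ne_of q x3).symm
        have hz := un1 q hq hltq
        have hp : p2 q = q := by linarith [hsum q hq]
        by_cases hv2 : v ∈ V2
        · have : L q v = L2 (p2 q) v := by
            by_cases hvt : v = t
            · rw [hvt, sink, min_eq_right hltq.le]
            · exact right hq hv2 hvt
          simp only [hv2, if_true]
          rw [this, aff2 q hq x2 v hv2, hp]
        · have hv1 := (Finset.mem_union.1 hv).resolve_right hv2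
          have hvt : v ≠ t := fun h => hv2 (h ▸ ht2)
          simp only [hv2, if_false]
          rw [left hv1 hvt, hz, mul_zero, zero_add]

end Parallel

section Structure

variable [DecidableEq V] {tail head : A → V}

theorem sum_filter_eq_zero {Aset : Finset A} {f : A → V} {x : A → ℝ} {v : V}
    (h : ∀ a ∈ Aset, f a ≠ v) : ∑ a ∈ Aset.filter (fun a => f a = v), x a = 0 := by
  rw [Finset.filter_eq_empty_iff.2 fun a ha => h a ha, Finset.sum_empty]

variable [DecidableEq A]

theorem SeriesParallel.terminals {Vset : Finset V} {Aset : Finset A} {s t : V}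
    (h : SeriesParallel tail head Vset Aset s t) :
    s ∈ Vset ∧ t ∈ Vset ∧ s ≠ t ∧
      ∀ a ∈ Aset, tail a ∈ Vset ∧ head a ∈ Vset ∧ head a ≠ s ∧ tail a ≠ t := by
  induction h with
  | base a s t hst h1 h2 => simp [h1, h2, hst, hst.symm]
  | @series V1 V2 A1 A2 s r t _ _ hV _ ih1 ih2 =>
    obtain ⟨s1, r1, sr, a1⟩ := ih1
    obtain ⟨r2, t2, rt, a2⟩ := ih2
    have hmem : ∀ v, v ∈ V1 → v ∈ V2 → v = r := fun v h1 h2 => by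
      rw [← Finset.mem_singleton, ← hV]; exact Finset.mem_inter.2 ⟨h1, h2⟩
    have hs2 : s ∉ V2 := fun h => sr (hmem s s1 h)
    have ht1 : t ∉ V1 := fun h => rt (hmem t h t2).symm
    refine ⟨Finset.mem_union_left _ s1, Finset.mem_union_right _ t2, fun e => hs2 (e ▸ t2), ?_⟩
    intro a ha
    rcases Finset.mem_union.1 ha with ha | ha
    · obtain ⟨x1, x2, x3, x4⟩ := a1 a ha
      exact ⟨Finset.mem_union_left _ x1, Finset.mem_union_left _ x2, x3, fun e => ht1 (e ▸ x1)⟩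
    · obtain ⟨x1, x2, x3, x4⟩ := a2 a ha
      exact ⟨Finset.mem_union_right _ x1, Finset.mem_union_right _ x2, fun e => hs2 (e ▸ x2), x4⟩
  | parallel _ _ _ _ ih1 ih2 =>
    obtain ⟨s1, t1, st, a1⟩ := ih1
    obtain ⟨s2, t2, _, a2⟩ := ih2
    refine ⟨Finset.mem_union_left _ s1, Finset.mem_union_left _ t1, st, ?_⟩
    intro a ha
    rcases Finset.mem_union.1 ha with ha | ha
    · obtain ⟨x1, x2, x3, x4⟩ := a1 a ha
      exact ⟨Finset.mem_union_left _ x1, Finset.mem_union_left _ x2, x3, x4⟩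
    · obtain ⟨x1, x2, x3, x4⟩ := a2 a ha
      exact ⟨Finset.mem_union_right _ x1, Finset.mem_union_right _ x2, x3, x4⟩

theorem outSumM_union {A1 A2 : Finset A} (hA : Disjoint A1 A2) (x : A → ℝ) (v : V) :
    outSumM (A1 ∪ A2) tail x v = outSumM A1 tail x v + outSumM A2 tail x v := by
  unfold outSumM
  rw [Finset.filter_union, Finset.sum_union (Finset.disjoint_filter_filter hA)]

theorem inSumM_union {A1 A2 : Finset A} (hA : Disjoint A1 A2) (x : A → ℝ) (v : V) :
    inSumM (A1 ∪ A2) head x v = inSumM A1 head x v + inSumM A2 head x v :=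
  outSumM_union hA x v

/-- The flow leaving the source equals the flow entering the sink. -/
theorem SeriesParallel.outSum_source_eq_inSum_sink {Vset : Finset V} {Aset : Finset A} {s t : V}
    (h : SeriesParallel tail head Vset Aset s t) {x : A → ℝ}
    (cons : ∀ v ∈ Vset, v ≠ s → v ≠ t → outSumM Aset tail x v = inSumM Aset head x v) :
    outSumM Aset tail x s = inSumM Aset head x t := by
  obtain ⟨hs, ht, hst, ha⟩ := h.terminals
  have e : ∑ v ∈ Vset, (outSumM Aset tail x v - inSumM Aset head x v) = 0 := by
    rw [Finset.sum_sub_distrib]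
    unfold outSumM inSumM
    rw [Finset.sum_fiberwise_of_maps_to (fun a h => (ha a h).1),
      Finset.sum_fiberwise_of_maps_to (fun a h => (ha a h).2.1), sub_self]
  have e2 : ∑ v ∈ Vset, (outSumM Aset tail x v - inSumM Aset head x v) =
      ∑ v ∈ {s, t}, (outSumM Aset tail x v - inSumM Aset head x v) := by
    symm
    refine Finset.sum_subset (by simp [Finset.insert_subset_iff, hs, ht]) fun v hv hn => ?_
    simp only [Finset.mem_insert, Finset.mem_singleton, not_or] at hn
    rw [cons v hv hn.1 hn.2, sub_self]
  rw [e2, Finset.sum_pair hst] at e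
  have z1 : inSumM Aset head x s = 0 := sum_filter_eq_zero fun a h => (ha a h).2.2.1
  have z2 : outSumM Aset tail x t = 0 := sum_filter_eq_zero fun a h => (ha a h).2.2.2
  linarith

theorem SeriesParallel.exists_arc_sink {Vset : Finset V} {Aset : Finset A} {s t : V}
    (h : SeriesParallel tail head Vset Aset s t) : ∃ a ∈ Aset, head a = t := by
  induction h with
  | base a s t hst h1 h2 => exact ⟨a, by simp, h2⟩
  | series _ _ _ _ _ ih2 =>
    obtain ⟨a, ha, e⟩ := ih2
    exact ⟨a, Finset.mem_union_right _ ha, e⟩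
  | parallel _ _ _ _ ih1 _ =>
    obtain ⟨a, ha, e⟩ := ih1
    exact ⟨a, Finset.mem_union_left _ ha, e⟩

end Structure

section Base

/-- The label function of a single arc of capacity `c`. -/
def arcLabel [DecidableEq V] (reset : Prop) [Decidable reset] (c : ℝ) (s : V) (q : ℝ) (v : V) : ℝ :=
  if v = s then 1 else if reset then q / c else max 1 (q / c)

variable [DecidableEq V]

theorem arcLabel_profile (reset : Prop) [Decidable reset] {c : ℝ} (hc : 0 < c) {s t : V}
    (hst : s ≠ t) :
    LabelProfile {s, t} s t (if reset then 0 else 1) (arcLabel reset c s) := by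
  have hs : ∀ q, arcLabel reset c s q s = 1 := fun q => if_pos rfl
  by_cases hr : reset
  · have ht : ∀ q, arcLabel reset c s q t = q / c := fun q => by
      simp [arcLabel, hst.symm, hr]
    refine ⟨fun q _ => hs q, ?_, ?_, ?_, ?_, ?_, ?_, ?_, ?_⟩
    · intro q hq; rw [ht]; positivity
    · intro q hq; rw [ht]; positivity
    · intro q q' _ h; rw [ht, ht]; gcongr
    · intro q q' _ h; rw [ht, ht]; apply le_of_eq; ring
    · intro q q' _ _ h v hv
      rcases Finset.mem_insert.1 hv with rfl | hv
      · rw [hs, hs]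
      · rw [Finset.mem_singleton.1 hv]; exact h
    · intro v hv
      rcases Finset.mem_insert.1 hv with rfl | hv
      · simp only [hs]; exact continuousOn_const
      · rw [Finset.mem_singleton.1 hv]; simp only [ht]; fun_prop
    · intro v hv
      rcases Finset.mem_insert.1 hv with rfl | hv
      · exact ⟨1, fun q hq => by rw [hs, abs_one]; linarith⟩
      · rw [Finset.mem_singleton.1 hv]
        refine ⟨1 / c, fun q hq => ?_⟩
        rw [ht, abs_of_nonneg (by positivity), div_mul_eq_mul_div]
        gcongr; linarith
    · refine ⟨fun _ => 0, by simp, by simp, fun _ => ⟨fun v => if v = s then 0 else 1 / c,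
        fun v => if v = s then 1 else 0, fun q _ _ v hv => ?_⟩⟩
      rcases Finset.mem_insert.1 hv with rfl | hv
      · simp [hs]
      · rw [Finset.mem_singleton.1 hv, ht]; simp [hst.symm, div_eq_mul_inv]
  · have ht : ∀ q, arcLabel reset c s q t = max 1 (q / c) := fun q => by
      simp [arcLabel, hst.symm, hr]
    refine ⟨fun q _ => hs q, ?_, ?_, ?_, ?_, ?_, ?_, ?_, ?_⟩
    · intro q hq; rw [ht]; positivity
    · intro q hq; rw [ht]; positivity
    · intro q q' _ h; rw [ht, ht]; gcongr
    · intro q q' h0 h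
      rw [ht, ht, mul_max_of_nonneg _ _ h0, mul_max_of_nonneg _ _ (h0.trans h)]
      refine max_le_max (by linarith) (le_of_eq (by ring))
    · intro q q' _ _ h v hv
      rcases Finset.mem_insert.1 hv with rfl | hv
      · rw [hs, hs]
      · rw [Finset.mem_singleton.1 hv]; exact h
    · intro v hv
      rcases Finset.mem_insert.1 hv with rfl | hv
      · simp only [hs]; exact continuousOn_const
      · rw [Finset.mem_singleton.1 hv]; simp only [ht]; fun_prop
    · intro v hv
      rcases Finset.mem_insert.1 hv with rfl | hv
      · exact ⟨1, fun q hq => by rw [hs, abs_one]; linarith⟩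
      · rw [Finset.mem_singleton.1 hv]
        refine ⟨1 + 1 / c, fun q hq => ?_⟩
        rw [ht, abs_of_nonneg (by positivity)]
        have : 0 < 1 / c := by positivity
        have e : q / c = 1 / c * q := by ring
        have : 0 ≤ 1 / c * q := by positivity
        refine max_le ?_ ?_
        · nlinarith
        · rw [e]; nlinarith
    · refine ⟨fun q => if q ≤ c then 0 else 1, fun q q' _ h => ?_, fun q _ => ?_, fun i => ?_⟩
      · dsimp only; split_ifs <;> first | omega | linarith
      · dsimp only; split_ifs <;> omega
      · by_cases hi : i = 0
        · refine ⟨0, 1, fun q _ hq v hv => ?_⟩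
          have hqc : q ≤ c := by
            by_contra h
            simp [h, hi] at hq
          rcases Finset.mem_insert.1 hv with rfl | hv
          · simp [hs]
          · rw [Finset.mem_singleton.1 hv, ht, max_eq_left ((div_le_one hc).2 hqc)]; simp
        · refine ⟨fun v => if v = s then 0 else 1 / c, fun v => if v = s then 1 else 0,
            fun q _ hq v hv => ?_⟩
          have hqc : c < q := by
            by_contra! h
            simp [h, Ne.symm hi] at hq
          rcases Finset.mem_insert.1 hv with rfl | hv
          · simp [hs]
          · rw [Finset.mem_singleton.1 hv, ht, max_eq_right ((one_le_div hc).2 hqc.le)]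
            simp [hst.symm, div_eq_mul_inv]

end Base

section Identification

variable [DecidableEq V] [DecidableEq A] {tail head : A → V} {Astar : Finset A} {nu : A → ℝ}

theorem arcLabel_determines {a : A} {s t : V} (hst : s ≠ t) (h1 : tail a = s) (h2 : head a = t) :
    DeterminesLabels {s, t} {a} tail head Astar nu s t (arcLabel (a ∈ Astar) (nu a) s) := by
  rintro x q l ⟨_, _, hval, _, hlab, _⟩
  have hx : x a = q := by
    have z : inSumM {a} head x s = 0 := sum_filter_eq_zero fun b hb => by
      rw [Finset.mem_singleton.1 hb, h2]; exact hst.symm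
    rw [z, sub_zero] at hval
    unfold outSumM at hval
    rwa [Finset.filter_singleton, if_pos h1, Finset.sum_singleton] at hval
  obtain ⟨b, hb, _, hl⟩ := (hlab t (by simp) hst.symm).2
  rw [Finset.mem_singleton.1 hb, h1, hx] at hl
  unfold arcRhoM at hl
  refine ⟨fun hpos v hv => ?_, fun h0 hq v hv => ?_⟩
  · rcases Finset.mem_insert.1 hv with rfl | hv
    · simp [arcLabel]
    · rw [Finset.mem_singleton.1 hv, hl]
      unfold arcLabel
      rw [if_neg hst.symm]
      split_ifs
      · field_simp
      · rw [mul_max_of_nonneg _ _ hpos.le, mul_one]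
        congr 1; field_simp
  · rcases Finset.mem_insert.1 hv with rfl | hv
    · exact h0
    · rw [Finset.mem_singleton.1 hv, hl, h0, hq]; simp

theorem seriesLabel_determines {V1 V2 : Finset V} {A1 A2 : Finset A} {s r t : V} {n1 n2 : ℕ}
    {L1 L2 : ℝ → V → ℝ} (g1 : SeriesParallel tail head V1 A1 s r)
    (g2 : SeriesParallel tail head V2 A2 r t) (hV : V1 ∩ V2 = {r}) (hA : Disjoint A1 A2)
    (H1 : LabelProfile V1 s r n1 L1) (H2 : LabelProfile V2 r t n2 L2)
    (D1 : DeterminesLabels V1 A1 tail head Astar nu s r L1)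
    (D2 : DeterminesLabels V2 A2 tail head Astar nu r t L2) :
    DeterminesLabels (V1 ∪ V2) (A1 ∪ A2) tail head Astar nu s t (seriesLabel V1 r L1 L2) := by
  rintro x q l ⟨hx, hcons, hval, hnn, hlab, hact⟩
  obtain ⟨s1, r1, sr, a1⟩ := g1.terminals
  obtain ⟨r2, t2, rt, a2⟩ := g2.terminals
  have hmem : ∀ v, v ∈ V1 → v ∈ V2 → v = r := fun v h1 h2 => by
    rw [← Finset.mem_singleton, ← hV]; exact Finset.mem_inter.2 ⟨h1, h2⟩
  have hs2 : s ∉ V2 := fun h => sr (hmem s s1 h)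
  have ht1 : t ∉ V1 := fun h => rt (hmem t h t2).symm
  have out1 : ∀ v ∈ V2, outSumM A1 tail x v = 0 := fun v hv =>
    sum_filter_eq_zero fun a ha e =>
      (a1 a ha).2.2.2 (hmem _ (a1 a ha).1 (e ▸ hv))
  have in2 : ∀ v ∈ V1, inSumM A2 head x v = 0 := fun v hv =>
    sum_filter_eq_zero fun a ha e =>
      (a2 a ha).2.2.1 (hmem _ (e ▸ hv) (a2 a ha).2.1)
  have out2 : ∀ v ∈ V1, v ≠ r → outSumM A2 tail x v = 0 := fun v hv hvr =>
    sum_filter_eq_zero fun a ha e => hvr (hmem v hv (e ▸ (a2 a ha).1))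
  have in1 : ∀ v ∈ V2, v ≠ r → inSumM A1 head x v = 0 := fun v hv hvr =>
    sum_filter_eq_zero fun a ha e => hvr (hmem v (e ▸ (a1 a ha).2.1) hv)
  simp only [outSumM_union hA, inSumM_union hA] at hcons hval
  have cons1 : ∀ v ∈ V1, v ≠ s → v ≠ r → outSumM A1 tail x v = inSumM A1 head x v := by
    intro v hv hvs hvr
    have := hcons v (Finset.mem_union_left _ hv) hvs fun e => ht1 (e ▸ hv)
    rw [out2 v hv hvr, in2 v hv] at this
    linarith
  have val1 : outSumM A1 tail x s - inSumM A1 head x s = q := by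
    rw [out2 s s1 sr, in2 s s1] at hval
    linarith
  have z1 : inSumM A1 head x s = 0 := sum_filter_eq_zero fun a h => (a1 a h).2.2.1
  have hq : 0 ≤ q := by
    rw [← val1, z1, sub_zero]
    exact Finset.sum_nonneg fun a ha => hx a (Finset.mem_union_left _ (Finset.mem_filter.1 ha).1)
  have N1 : IsNTFM V1 A1 tail head Astar nu s r x q l := by
    refine ⟨fun a ha => hx a (Finset.mem_union_left _ ha), cons1, val1,
      fun v hv => hnn v (Finset.mem_union_left _ hv), fun w hw hws => ?_,
      fun a ha => hact a (Finset.mem_union_left _ ha)⟩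
    obtain ⟨y1, a, ha, y2, y3⟩ := hlab w (Finset.mem_union_left _ hw) hws
    refine ⟨fun a ha => y1 a (Finset.mem_union_left _ ha), a, ?_, y2, y3⟩
    refine (Finset.mem_union.1 ha).resolve_right fun h => ?_
    exact (a2 a h).2.2.1 (hmem _ (y2 ▸ hw) (a2 a h).2.1)
  have N2 : IsNTFM V2 A2 tail head Astar nu r t x q l := by
    refine ⟨fun a ha => hx a (Finset.mem_union_right _ ha), fun v hv hvr hvt => ?_, ?_,
      fun v hv => hnn v (Finset.mem_union_right _ hv), fun w hw hwr => ?_,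
      fun a ha => hact a (Finset.mem_union_right _ ha)⟩
    · have := hcons v (Finset.mem_union_right _ hv) (fun e => hs2 (e ▸ hv)) hvt
      rw [out1 v hv, in1 v hv hvr] at this
      linarith
    · have h := hcons r (Finset.mem_union_left _ r1) sr.symm rt
      rw [out1 r r2] at h
      have f := g1.outSum_source_eq_inSum_sink cons1
      rw [in2 r r1] at h ⊢
      linarith
    · obtain ⟨y1, a, ha, y2, y3⟩ := hlab w (Finset.mem_union_right _ hw) fun e => hs2 (e ▸ hw)
      refine ⟨fun a ha => y1 a (Finset.mem_union_right _ ha), a, ?_, y2, y3⟩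
      refine (Finset.mem_union.1 ha).resolve_left fun h => ?_
      exact hwr (hmem w (y2 ▸ (a1 a h).2.1) hw)
  obtain ⟨P1, Z1⟩ := D1 x q l N1
  obtain ⟨P2, Z2⟩ := D2 x q l N2
  refine ⟨fun hpos v hv => ?_, fun h0 hq0 v hv => ?_⟩
  · have hqs : 0 ≤ q / l s := div_nonneg hq hpos.le
    by_cases hv1 : v ∈ V1
    · rw [seriesLabel_left hv1]; exact P1 hpos v hv1
    · have hv2 := (Finset.mem_union.1 hv).resolve_left hv1
      rw [seriesLabel_right H2 H1 hV hqs hv2]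
      have er := P1 hpos r r1
      rcases (H1.nonneg _ hqs).eq_or_lt with e | e
      · have hz := H1.eq_zero_of_sink_eq_zero hqs e.symm
        rw [← e, mul_zero] at er
        have hq0 : q = 0 := by
          rcases div_eq_zero_iff.1 hz with h | h
          · exact h
          · exact absurd h hpos.ne'
        rw [Z2 er hq0 v hv2, ← e]; simp
      · have hrpos : 0 < l r := er ▸ mul_pos hpos e
        rw [P2 hrpos v hv2, er, div_div, mul_assoc]
  · by_cases hv1 : v ∈ V1
    · exact Z1 h0 hq0 v hv1
    · exact Z2 (Z1 h0 hq0 r r1) hq0 v ((Finset.mem_union.1 hv).resolve_left hv1)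

/-- A thin flow restricted to a component of a parallel composition, with the label at the sink
replaced by the label this component alone would give it. -/
theorem SeriesParallel.restrict_parallel {V1 W : Finset V} {A1 B : Finset A} {s t : V}
    (g1 : SeriesParallel tail head V1 A1 s t) (hVW : V1 ⊆ W) (hAB : A1 ⊆ B)
    (hout : ∀ x v, v ∈ V1 → v ≠ s → v ≠ t → outSumM B tail x v = outSumM A1 tail x v)
    (hin : ∀ a ∈ B, head a ∈ V1 → head a ≠ t → a ∈ A1)
    {x : A → ℝ} {q : ℝ} {l : V → ℝ} (N : IsNTFM W B tail head Astar nu s t x q l) :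
    ∃ m, IsNTFM V1 A1 tail head Astar nu s t x (outSumM A1 tail x s) (Function.update l t m) ∧
      l t ≤ m ∧ (0 < outSumM A1 tail x s → l t = m) ∧
      ∃ a ∈ A1, head a = t ∧ m = arcRhoM Astar nu a (l (tail a)) (x a) := by
  obtain ⟨hx, hcons, hval, hnn, hlab, hact⟩ := N
  obtain ⟨s1, t1, st, a1⟩ := g1.terminals
  obtain ⟨a0, ha0, e0⟩ := g1.exists_arc_sink
  obtain ⟨b, hb, hmin⟩ := Finset.exists_min_image (A1.filter fun a => head a = t)
    (fun a => arcRhoM Astar nu a (l (tail a)) (x a)) ⟨a0, Finset.mem_filter.2 ⟨ha0, e0⟩⟩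
  obtain ⟨hb1, hbt⟩ := Finset.mem_filter.1 hb
  have lt_le : ∀ a ∈ A1, head a = t → l t ≤ arcRhoM Astar nu a (l (tail a)) (x a) :=
    fun a ha e => (hlab t (hVW t1) st.symm).1 a (hAB ha) e
  set m := arcRhoM Astar nu b (l (tail b)) (x b)
  have htail : ∀ a ∈ A1, Function.update l t m (tail a) = l (tail a) := fun a ha =>
    Function.update_of_ne (a1 a ha).2.2.2 _ _
  have active : ∀ a ∈ A1, head a = t → 0 < x a → l t = m := by
    intro a ha e hpos
    refine le_antisymm (lt_le b hb1 hbt) ?_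
    have h := hact a (hAB ha) hpos
    rw [e] at h
    rw [h]
    exact hmin a (Finset.mem_filter.2 ⟨ha, e⟩)
  have cons : ∀ v ∈ V1, v ≠ s → v ≠ t → outSumM A1 tail x v = inSumM A1 head x v := by
    intro v hv hvs hvt
    rw [← hout x v hv hvs hvt, hcons v (hVW hv) hvs hvt]
    unfold inSumM
    refine Finset.sum_congr (Finset.ext fun a => ?_) fun _ _ => rfl
    simp only [Finset.mem_filter]
    refine ⟨fun ⟨h, e⟩ => ⟨hin a h (e ▸ hv) (e ▸ hvt), e⟩, fun ⟨h, e⟩ => ⟨hAB h, e⟩⟩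
  refine ⟨m, ⟨fun a ha => hx a (hAB ha), cons, ?_, ?_, ?_, ?_⟩, lt_le b hb1 hbt, ?_, b, hb1, hbt,
    rfl⟩
  · have z1 : inSumM A1 head x s = 0 := sum_filter_eq_zero fun a h => (a1 a h).2.2.1
    rw [z1, sub_zero]
  · intro v hv
    by_cases hvt : v = t
    · rw [hvt, Function.update_self]
      exact (hnn t (hVW t1)).trans (lt_le b hb1 hbt)
    · rw [Function.update_of_ne hvt]; exact hnn v (hVW hv)
  · intro w hw hws
    by_cases hwt : w = t
    · rw [hwt, Function.update_self]
      refine ⟨fun a ha e => ?_, b, hb1, hbt, by rw [htail b hb1]⟩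
      rw [htail a ha]; exact hmin a (Finset.mem_filter.2 ⟨ha, e⟩)
    · rw [Function.update_of_ne hwt]
      obtain ⟨y1, a, ha, y2, y3⟩ := hlab w (hVW hw) hws
      have haA := hin a ha (y2 ▸ hw) (y2 ▸ hwt)
      exact ⟨fun a ha e => by rw [htail a ha]; exact y1 a (hAB ha) e, a, haA, y2,
        by rw [htail a haA]; exact y3⟩
  · intro a ha hpos
    rw [htail a ha]
    by_cases e : head a = t
    · rw [e, Function.update_self, ← active a ha e hpos, ← e]; exact hact a (hAB ha) hpos
    · rw [Function.update_of_ne e]; exact hact a (hAB ha) hpos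
  · intro hpos
    rw [g1.outSum_source_eq_inSum_sink cons] at hpos
    obtain ⟨a, ha, hxa⟩ := Finset.exists_lt_of_sum_lt (f := fun _ => (0 : ℝ)) (g := x)
      (s := A1.filter fun a => head a = t) (by simpa [inSumM] using hpos)
    obtain ⟨ha1, e⟩ := Finset.mem_filter.1 ha
    exact active a ha1 e hxa

theorem parallelLabel_determines {V1 V2 : Finset V} {A1 A2 : Finset A} {s t : V} {n1 n2 : ℕ}
    {L1 L2 : ℝ → V → ℝ} {p1 p2 : ℝ → ℝ} (g1 : SeriesParallel tail head V1 A1 s t)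
    (g2 : SeriesParallel tail head V2 A2 s t) (hV : V1 ∩ V2 = {s, t}) (hA : Disjoint A1 A2)
    (H1 : LabelProfile V1 s t n1 L1) (H2 : LabelProfile V2 s t n2 L2)
    (D1 : DeterminesLabels V1 A1 tail head Astar nu s t L1)
    (D2 : DeterminesLabels V2 A2 tail head Astar nu s t L2)
    (sp : ∀ q, 0 ≤ q → IsSplit (fun y => L1 y t) (fun y => L2 y t) q (p1 q) (p2 q)) :
    DeterminesLabels (V1 ∪ V2) (A1 ∪ A2) tail head Astar nu s t
      (parallelLabel V1 t L1 L2 p1 p2) := by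
  intro x q l N
  obtain ⟨s1, t1, st, a1⟩ := g1.terminals
  obtain ⟨s2, t2, _, a2⟩ := g2.terminals
  have hmem : ∀ v, v ∈ V1 → v ∈ V2 → v = s ∨ v = t := fun v h1 h2 => by
    have : v ∈ V1 ∩ V2 := Finset.mem_inter.2 ⟨h1, h2⟩
    rwa [hV, Finset.mem_insert, Finset.mem_singleton] at this
  obtain ⟨m1, N1, le1, eq1, b1, hb1, hbt1, em1⟩ := g1.restrict_parallel
    Finset.subset_union_left Finset.subset_union_left
    (fun x v hv hvs hvt => by
      have z : outSumM A2 tail x v = 0 := sum_filter_eq_zero fun a ha e =>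
        (hmem v hv (e ▸ (a2 a ha).1)).elim hvs hvt
      rw [outSumM_union hA, z, add_zero])
    (fun a ha h h' => (Finset.mem_union.1 ha).resolve_right fun h2 =>
      (hmem _ h (a2 a h2).2.1).elim (a2 a h2).2.2.1 h') N
  obtain ⟨m2, N2, le2, eq2, b2, hb2, hbt2, em2⟩ := g2.restrict_parallel
    Finset.subset_union_right Finset.subset_union_right
    (fun x v hv hvs hvt => by
      have z : outSumM A1 tail x v = 0 := sum_filter_eq_zero fun a ha e =>
        (hmem v (e ▸ (a1 a ha).1) hv).elim hvs hvt
      rw [outSumM_union hA, z, zero_add])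
    (fun a ha h h' => (Finset.mem_union.1 ha).resolve_left fun h2 =>
      (hmem _ (a1 a h2).2.1 h).elim (a1 a h2).2.2.1 h') N
  obtain ⟨hx, _, hval, _, hlab, _⟩ := N
  have hsum : outSumM A1 tail x s + outSumM A2 tail x s = q := by
    have z1 : inSumM A1 head x s = 0 := sum_filter_eq_zero fun a h => (a1 a h).2.2.1
    have z2 : inSumM A2 head x s = 0 := sum_filter_eq_zero fun a h => (a2 a h).2.2.1
    rw [outSumM_union hA, inSumM_union hA, z1, z2] at hval
    linarith
  have nn1 : 0 ≤ outSumM A1 tail x s :=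
    Finset.sum_nonneg fun a ha => hx a (Finset.mem_union_left _ (Finset.mem_filter.1 ha).1)
  have nn2 : 0 ≤ outSumM A2 tail x s :=
    Finset.sum_nonneg fun a ha => hx a (Finset.mem_union_right _ (Finset.mem_filter.1 ha).1)
  have hlt : l t = min m1 m2 := by
    refine le_antisymm (le_min le1 le2) ?_
    obtain ⟨_, a, ha, y2, y3⟩ := hlab t (Finset.mem_union_left _ t1) st.symm
    rcases Finset.mem_union.1 ha with ha | ha
    · have h := (N1.2.2.2.2.1 t t1 st.symm).1 a ha y2
      rw [Function.update_self, Function.update_of_ne (a1 a ha).2.2.2, ← y3] at h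
      exact (min_le_left _ _).trans h
    · have h := (N2.2.2.2.2.1 t t2 st.symm).1 a ha y2
      rw [Function.update_self, Function.update_of_ne (a2 a ha).2.2.2, ← y3] at h
      exact (min_le_right _ _).trans h
  obtain ⟨P1, Z1⟩ := D1 _ _ _ N1
  obtain ⟨P2, Z2⟩ := D2 _ _ _ N2
  rw [Function.update_of_ne st] at P1 Z1 P2 Z2
  set y1 := outSumM A1 tail x s
  set y2 := outSumM A2 tail x s
  refine ⟨fun hpos v hv => ?_, fun h0 hq0 v hv => ?_⟩
  · have hq : 0 ≤ q / l s := div_nonneg (by linarith) hpos.le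
    have et1 := P1 hpos t t1
    have et2 := P2 hpos t t2
    rw [Function.update_self] at et1 et2
    have S : IsSplit (fun y => L1 y t) (fun y => L2 y t) (q / l s) (y1 / l s) (y2 / l s) := by
      refine ⟨div_nonneg nn1 hpos.le, div_nonneg nn2 hpos.le, by rw [← add_div, hsum], ?_, ?_⟩
      · intro h
        have h' : 0 < y1 := by
          by_contra! hc
          exact absurd h (div_nonpos_of_nonpos_of_nonneg hc hpos.le).not_gt
        have := (eq1 h').symm.le.trans le2
        rw [et1, et2] at this
        exact le_of_mul_le_mul_left this hpos
      · intro h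
        have h' : 0 < y2 := by
          by_contra! hc
          exact absurd h (div_nonpos_of_nonpos_of_nonneg hc hpos.le).not_gt
        have := (eq2 h').symm.le.trans le1
        rw [et1, et2] at this
        exact le_of_mul_le_mul_left this hpos
    have S0 := sp _ hq
    obtain ⟨E1, E2⟩ := S.labels_eq H1.mono H2.mono S0
    by_cases hvt : v = t
    · rw [hvt, parallelLabel_sink, hlt, et1, et2, mul_min_of_nonneg _ _ hpos.le]
      exact congrArg₂ min (congrArg _ E1) (congrArg _ E2)
    rcases Finset.mem_union.1 hv with hv | hv
    · rw [parallelLabel_left hv hvt,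
        ← H1.determined _ _ S.left_nonneg S0.left_nonneg E1 v hv, ← P1 hpos v hv,
        Function.update_of_ne hvt]
    · rw [parallelLabel_right H1 H2 hV S0.left_nonneg S0.right_nonneg hv hvt,
        ← H2.determined _ _ S.right_nonneg S0.right_nonneg E2 v hv, ← P2 hpos v hv,
        Function.update_of_ne hvt]
  · have e1 : y1 = 0 := by linarith
    have e2 : y2 = 0 := by linarith
    by_cases hvt : v = t
    · have u1 := Z1 h0 e1 t t1
      have u2 := Z2 h0 e2 t t2
      rw [Function.update_self] at u1 u2
      rw [hvt, hlt, u1, u2, min_self]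
    rcases Finset.mem_union.1 hv with hv | hv
    · have := Z1 h0 e1 v hv
      rwa [Function.update_of_ne hvt] at this
    · have := Z2 h0 e2 v hv
      rwa [Function.update_of_ne hvt] at this

theorem SeriesParallel.exists_labelProfile {Vset : Finset V} {Aset : Finset A} {s t : V}
    (h : SeriesParallel tail head Vset Aset s t) (hnu : ∀ a ∈ Aset, 0 < nu a) :
    ∃ (n : ℕ) (L : ℝ → V → ℝ), LabelProfile Vset s t n L ∧
      DeterminesLabels Vset Aset tail head Astar nu s t L ∧
      (n : ℤ) = 2 * (Aset.card : ℤ) - ((Aset ∩ Astar).card : ℤ) - (Vset.card : ℤ) + 1 := by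
  induction h with
  | base a s t hst h1 h2 =>
    refine ⟨_, _, arcLabel_profile (a ∈ Astar) (hnu a (by simp)) hst,
      arcLabel_determines hst h1 h2, ?_⟩
    rw [Finset.card_pair hst]
    by_cases ha : a ∈ Astar
    · simp [ha]
    · simp [ha]
  | @series V1 V2 A1 A2 s r t g1 g2 hV hA ih1 ih2 =>
    obtain ⟨n1, L1, H1, D1, e1⟩ := ih1 fun a ha => hnu a (Finset.mem_union_left _ ha)
    obtain ⟨n2, L2, H2, D2, e2⟩ := ih2 fun a ha => hnu a (Finset.mem_union_right _ ha)
    refine ⟨_, _, H1.series H2 hV g1.terminals.1 g2.terminals.2.1 g1.terminals.2.1,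
      seriesLabel_determines g1 g2 hV hA H1 H2 D1 D2, ?_⟩
    have cV := Finset.card_union_add_card_inter V1 V2
    rw [hV, Finset.card_singleton] at cV
    rw [Finset.union_inter_distrib_right, Finset.card_union_of_disjoint hA,
      Finset.card_union_of_disjoint (hA.mono Finset.inter_subset_left Finset.inter_subset_left)]
    push_cast
    omega
  | @parallel V1 V2 A1 A2 s t g1 g2 hV hA ih1 ih2 =>
    obtain ⟨n1, L1, H1, D1, e1⟩ := ih1 fun a ha => hnu a (Finset.mem_union_left _ ha)
    obtain ⟨n2, L2, H2, D2, e2⟩ := ih2 fun a ha => hnu a (Finset.mem_union_right _ ha)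
    obtain ⟨s1, t1, st, _⟩ := g1.terminals
    obtain ⟨p1, p2, sp, m⟩ := exists_monotone_split (fun y => L1 y t) (fun y => L2 y t)
      H1.mono H2.mono (H1.cont t t1) (H2.cont t g2.terminals.2.1)
    refine ⟨_, _, H1.parallel H2 hV st sp m,
      parallelLabel_determines g1 g2 hV hA H1 H2 D1 D2 sp, ?_⟩
    have cV := Finset.card_union_add_card_inter V1 V2
    rw [hV, Finset.card_pair st] at cV
    rw [Finset.union_inter_distrib_right, Finset.card_union_of_disjoint hA,
      Finset.card_union_of_disjoint (hA.mono Finset.inter_subset_left Finset.inter_subset_left)]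
    push_cast
    omega

end Identification

theorem exists_affinePieces_of_index {E : Type*} [AddCommGroup E] [Module ℝ E] {f : ℝ → E} {n : ℕ}
    (k : ℝ → ℕ) (mk : ∀ q q', 0 ≤ q → q ≤ q' → k q ≤ k q') (bk : ∀ q, 0 ≤ q → k q ≤ n)
    (ak : ∀ i, ∃ c d : E, ∀ q, 0 ≤ q → k q = i → f q = q • c + d) :
    ∃ m ≤ n, AffinePieces f (m + 1) := by
  classical
  let P : Finset (Set ℝ) := (Finset.range (n + 1)).image fun i => {q | 0 ≤ q ∧ k q = i}
  have hP : ∀ I, I ∈ P ↔ ∃ i < n + 1, {q | 0 ≤ q ∧ k q = i} = I := by simp [P]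
  have hpos : 0 < P.card := Finset.card_pos.2 (Finset.Nonempty.image (by simp) _)
  have hcard : P.card ≤ n + 1 := Finset.card_image_le.trans (by simp)
  refine ⟨P.card - 1, by omega, P, by omega, ?_, ?_, ?_, ?_⟩
  · ext q
    simp only [Set.mem_sUnion, Finset.mem_coe, hP, Set.mem_Ici]
    constructor
    · rintro ⟨_, ⟨i, _, rfl⟩, hq⟩
      exact hq.1
    · exact fun hq => ⟨_, ⟨k q, Nat.lt_succ_of_le (bk q hq), rfl⟩, hq, rfl⟩
  · intro I hI J hJ hne
    obtain ⟨i, _, rfl⟩ := (hP I).1 hI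
    obtain ⟨j, _, rfl⟩ := (hP J).1 hJ
    ext q
    simp only [Set.mem_inter_iff, Set.mem_ofPred_eq, Set.mem_empty_iff_false, iff_false]
    rintro ⟨⟨_, rfl⟩, _, rfl⟩
    exact hne rfl
  · intro I hI
    obtain ⟨i, _, rfl⟩ := (hP I).1 hI
    refine ⟨fun a ha b hb y hy => ⟨ha.1.trans hy.1, ?_⟩⟩
    have u1 := mk a y ha.1 hy.1
    have u2 := mk y b (ha.1.trans hy.1) hy.2
    have u3 := ha.2
    have u4 := hb.2
    omega
  · intro I hI
    obtain ⟨i, _, rfl⟩ := (hP I).1 hI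
    obtain ⟨c, d, h⟩ := ak i
    exact ⟨c, d, fun q hq => h q hq.1 hq.2⟩

/-- The label function of a two-terminal series-parallel
graph is continuous and piecewise linear with at most
`2|A'| − |A*| − |V| + 1` breakpoints. -/
theorem statement19 [DecidableEq V] [DecidableEq A]
    (tail head : A → V) (Vset : Finset V) (Aset : Finset A) (s t : V)
    (hsp : SeriesParallel tail head Vset Aset s t)
    (Astar : Finset A) (hAstar : Astar ⊆ Aset)
    (nu : A → ℝ) (hnu : ∀ a ∈ Aset, 0 < nu a)
    (rho : ℝ → V → ℝ)
    (hrho : ∀ q : ℝ, 0 ≤ q → ∃ x : A → ℝ,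
      IsNTFM Vset Aset tail head Astar nu s t x q (rho q) ∧ rho q s = 1) :
    ContinuousOn (fun q => fun v : {v // v ∈ Vset} => rho q v.val) (Set.Ici 0) ∧
    (∃ m : ℕ, AffinePieces (fun q (v : {v // v ∈ Vset}) => rho q v.val) m) ∧
    (breakpoints (fun q (v : {v // v ∈ Vset}) => rho q v.val) : ℤ) ≤
      2 * (Aset.card : ℤ) - (Astar.card : ℤ) - (Vset.card : ℤ) + 1 := by
  obtain ⟨n, L, H, D, hn⟩ := hsp.exists_labelProfile (Astar := Astar) hnu
  have hrL : ∀ q, 0 ≤ q → ∀ v ∈ Vset, rho q v = L q v := by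
    intro q hq v hv
    obtain ⟨x, N, h1⟩ := hrho q hq
    have h := (D x q (rho q) N).1 (by rw [h1]; exact one_pos) v hv
    rwa [h1, one_mul, div_one] at h
  obtain ⟨k, mk, bk, ak⟩ := H.pieces
  obtain ⟨m, hm, hP⟩ := exists_affinePieces_of_index
    (f := fun q (v : {v // v ∈ Vset}) => rho q v.val) k mk bk fun i => by
      obtain ⟨c, d, h⟩ := ak i
      refine ⟨fun v => c v.val, fun v => d v.val, fun q hq hk => ?_⟩
      funext v
      rw [hrL q hq v.val v.property, h q hq hk v.val v.property]
      rfl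
  refine ⟨?_, ⟨m + 1, hP⟩, ?_⟩
  · refine continuousOn_pi.2 fun v => ?_
    exact (H.cont v.val v.property).congr fun q hq => hrL q hq v.val v.property
  · have hb : breakpoints (fun q (v : {v // v ∈ Vset}) => rho q v.val) ≤ m := Nat.sInf_le hP
    rw [Finset.inter_eq_right.2 hAstar] at hn
    omega
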